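/- arXiv:2205.14078 — 3 statements merged into one kernel-verified Lean document; each statement's English description precedes it below -/
import Mathlib

section
/- For every k ∈ ℕ, in the formal power series ring (ℤ[q])[[t]] one has (Σ_{n≥0} S_B[n,k] t^n) · (1 − [1]_q t)(1 − [3]_q t)⋯(1 − [2k+1]_q t) = t^k; that is, the ordinary generating function Σ_{n≥0} S_B[n,k] t^n equals t^k / ((1 − [1]_q t)(1 − [3]_q t)⋯(1 − [2k+1]_q t)). -/
open Polynomial Finset

/-- The q-integer [m]_q = 1 + q + ... + q^(m-1) in ℤ[q]. -/
noncomputable def qInt (m : ℕ) : Polynomial ℤ := ∑ i ∈ Finset.range m, Polynomial.X ^ i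

/-- Type B q-Stirling numbers of the second kind. -/
noncomputable def SB : ℕ → ℕ → Polynomial ℤ
  | 0, k => if k = 0 then 1 else 0
  | n+1, 0 => qInt 1 * SB n 0
  | n+1, k+1 => SB n k + qInt (2*(k+1)+1) * SB n (k+1)

theorem mk_SB_zero_mul :
    (PowerSeries.mk fun n => SB n 0) *
      (1 - PowerSeries.C (R := Polynomial ℤ) (qInt 1) * PowerSeries.X) = 1 := by
  ext1 n
  rw [mul_sub, mul_one, mul_left_comm]
  cases n with
  | zero => simp [SB]
  | succ n =>
    simp [SB, PowerSeries.coeff_succ_mul_X, PowerSeries.coeff_one]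

theorem mk_SB_succ_mul (k : ℕ) :
    (PowerSeries.mk fun n => SB n (k + 1)) *
      (1 - PowerSeries.C (R := Polynomial ℤ) (qInt (2 * (k + 1) + 1)) * PowerSeries.X)
      = (PowerSeries.mk fun n => SB n k) * PowerSeries.X := by
  ext1 n
  rw [mul_sub, mul_one, mul_left_comm]
  cases n with
  | zero => simp [SB]
  | succ n =>
    simp [SB, PowerSeries.coeff_succ_mul_X]

theorem SB_ogf (k : ℕ) :
    (PowerSeries.mk fun n => SB n k) *
      ∏ i ∈ Finset.range (k+1),
        (1 - PowerSeries.C (R := Polynomial ℤ) (qInt (2*i+1)) * PowerSeries.X)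
      = PowerSeries.X ^ k := by
  induction k with
  | zero => simpa using mk_SB_zero_mul
  | succ k ih =>
    rw [Finset.prod_range_succ, mul_left_comm, mk_SB_succ_mul, pow_succ, ← ih]
    ring
end

section
/- For every k ∈ ℕ, in the formal power series ring ℚ[[X]] one has 2^k · k! · Σ_{n≥0} (S_B(n,k)/n!) X^n = exp(X) · (exp(2X) − 1)^k, where exp(X) = Σ_{n≥0} X^n/n! and exp(2X) = Σ_{n≥0} 2^n X^n/n!. Equivalently, the exponential generating function of the type B Stirling numbers of the second kind is Σ_{n≥0} S_B(n,k) x^n/n! = (1/(2^k k!)) e^x (e^{2x} − 1)^k. -/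
open Finset PowerSeries

/-- Type B Stirling numbers of the second kind. -/
def SBnat : ℕ → ℕ → ℕ
  | 0, k => if k = 0 then 1 else 0
  | n+1, 0 => SBnat n 0
  | n+1, k+1 => SBnat n k + (2*(k+1)+1) * SBnat n (k+1)

theorem rescale_two_exp : rescale (2 : ℚ) (exp ℚ) = exp ℚ ^ 2 := by
  simpa using (exp_pow_eq_rescale_exp (A := ℚ) 2).symm

theorem derivative_exp_mul_exp_sq_sub_one_pow_succ (k : ℕ) :
    derivative ℚ (exp ℚ * (exp ℚ ^ 2 - 1) ^ (k + 1)) =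
      C (2 * (k + 1) + 1 : ℚ) * (exp ℚ * (exp ℚ ^ 2 - 1) ^ (k + 1)) +
        C (2 * (k + 1) : ℚ) * (exp ℚ * (exp ℚ ^ 2 - 1) ^ k) := by
  have h2 : (C (2 : ℚ) : ℚ⟦X⟧) = 2 := map_ofNat _ 2
  have hk : (C (k : ℚ) : ℚ⟦X⟧) = k := map_natCast _ k
  simp only [Derivation.leibniz, derivative_pow, map_sub, derivative_exp, derivative_one,
    smul_eq_mul, map_add, map_mul, map_one, h2, hk]
  push_cast
  ring

theorem factorial_mul_coeff_exp_mul_exp_sq_sub_one_pow (n k : ℕ) :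
    (n.factorial : ℚ) * coeff n (exp ℚ * (exp ℚ ^ 2 - 1) ^ k) =
      2 ^ k * k.factorial * SBnat n k := by
  induction n generalizing k with
  | zero => cases k <;> simp [SBnat]
  | succ n ih =>
    have hfac : ((n + 1).factorial : ℚ) = n.factorial * (n + 1) := by
      rw [Nat.factorial_succ]; push_cast; ring
    rw [hfac, mul_assoc, mul_comm ((n : ℚ) + 1), ← coeff_derivative]
    cases k with
    | zero => simpa [SBnat, derivative_exp] using ih 0
    | succ k =>
      rw [derivative_exp_mul_exp_sq_sub_one_pow_succ, map_add, coeff_C_mul, coeff_C_mul, SBnat]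
      have h₁ := ih (k + 1)
      have h₀ := ih k
      rw [Nat.factorial_succ] at h₁ ⊢
      push_cast at h₁ ⊢
      linear_combination (2 * (k + 1) + 1 : ℚ) * h₁ + (2 * (k + 1) : ℚ) * h₀

theorem SBnat_egf (k : ℕ) :
    PowerSeries.C (R := ℚ) ((2:ℚ)^k * k.factorial) *
        PowerSeries.mk (fun n => (SBnat n k : ℚ) / n.factorial)
      = PowerSeries.exp ℚ * (PowerSeries.rescale (2:ℚ) (PowerSeries.exp ℚ) - 1)^k := by
  ext n
  have hn : (n.factorial : ℚ) ≠ 0 := by exact_mod_cast n.factorial_ne_zero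
  rw [rescale_two_exp, coeff_C_mul, coeff_mk, mul_div_assoc', div_eq_iff hn,
    ← factorial_mul_coeff_exp_mul_exp_sq_sub_one_pow, mul_comm]
end

section
/- For every k ∈ ℕ, in the formal power series ring ℚ[[X]] one has k! · Σ_{n≥0} (c_B(n,k)/n!) X^n = (Σ_{n≥0} ((2n−1)!!/n!) X^n) · (Σ_{n≥1} (2^{n−1}/n) X^n)^k, where (2n−1)!! = ∏_{j=1}^n (2j−1) with (−1)!! = 1. (The two series on the right are the Maclaurin expansions of 1/√(1−2x) and of log(1/√(1−2x)), so this is the identity Σ_{n≥0} c_B(n,k) x^n/n! = (1/(k!√(1−2x))) (log(1/√(1−2x)))^k.) -/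
open Finset PowerSeries

/-- Type B Stirling numbers of the first kind (signless). -/
def cBnat : ℕ → ℕ → ℕ
  | 0, k => if k = 0 then 1 else 0
  | n+1, 0 => (2*n+1) * cBnat n 0
  | n+1, k+1 => cBnat n k + (2*n+1) * cBnat n (k+1)

theorem coeff_succ_one_sub_two_X_mul_derivative (f : ℚ⟦X⟧) (n : ℕ) :
    coeff n ((1 - 2 * X) * d⁄dX ℚ f) = (n + 1) * coeff (n + 1) f - 2 * n * coeff n f := by
  have h : (1 - 2 * X) * d⁄dX ℚ f = d⁄dX ℚ f - C (2 : ℚ) * (X * d⁄dX ℚ f) := by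
    rw [map_ofNat]; ring
  rw [h, map_sub, coeff_C_mul, coeff_derivative]
  cases n with
  | zero => simp
  | succ n =>
    rw [coeff_succ_X_mul, coeff_derivative]
    push_cast
    ring

/-- A formal solution of `(1 - 2X) f' = f + g` is determined by `g` and its constant term. -/
theorem eq_of_one_sub_two_X_mul_derivative {f₁ f₂ g : ℚ⟦X⟧}
    (h₁ : (1 - 2 * X) * d⁄dX ℚ f₁ = f₁ + g) (h₂ : (1 - 2 * X) * d⁄dX ℚ f₂ = f₂ + g)
    (h₀ : coeff 0 f₁ = coeff 0 f₂) : f₁ = f₂ := by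
  ext n
  induction n with
  | zero => exact h₀
  | succ n ih =>
    have e₁ := congrArg (coeff n) h₁
    have e₂ := congrArg (coeff n) h₂
    rw [coeff_succ_one_sub_two_X_mul_derivative, map_add] at e₁ e₂
    rw [ih] at e₁
    have hn : (n + 1 : ℚ) ≠ 0 := by positivity
    exact mul_left_cancel₀ hn (by linarith)

theorem one_sub_two_X_mul_derivative_oddFactorial :
    (1 - 2 * X) * d⁄dX ℚ (PowerSeries.mk
        (fun n => ((∏ j ∈ Finset.range n, (2*j+1) : ℕ) : ℚ) / n.factorial))
      = PowerSeries.mk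
        (fun n => ((∏ j ∈ Finset.range n, (2*j+1) : ℕ) : ℚ) / n.factorial) := by
  ext n
  rw [coeff_succ_one_sub_two_X_mul_derivative, coeff_mk, coeff_mk, Finset.prod_range_succ,
    Nat.factorial_succ]
  push_cast
  field_simp
  ring

theorem one_sub_two_X_mul_derivative_log :
    (1 - 2 * X) * d⁄dX ℚ (PowerSeries.mk
        (fun n => if n = 0 then 0 else (2:ℚ)^(n-1) / n)) = 1 := by
  ext n
  rw [coeff_succ_one_sub_two_X_mul_derivative, coeff_mk, coeff_mk, coeff_one]
  cases n with
  | zero => simp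
  | succ n =>
    simp only [Nat.add_eq_zero_iff, one_ne_zero, and_false, if_false, Nat.add_sub_cancel]
    push_cast
    field_simp
    ring

theorem one_sub_two_X_mul_derivative_cBnat_succ (k : ℕ) :
    (1 - 2 * X) * d⁄dX ℚ (PowerSeries.mk (fun n => (cBnat n (k + 1) : ℚ) / n.factorial))
      = PowerSeries.mk (fun n => (cBnat n (k + 1) : ℚ) / n.factorial)
        + PowerSeries.mk (fun n => (cBnat n k : ℚ) / n.factorial) := by
  ext n
  rw [coeff_succ_one_sub_two_X_mul_derivative, map_add, coeff_mk, coeff_mk, coeff_mk, cBnat,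
    Nat.factorial_succ]
  push_cast
  field_simp
  ring

theorem cBnat_zero_right (n : ℕ) : cBnat n 0 = ∏ j ∈ Finset.range n, (2*j+1) := by
  induction n with
  | zero => simp [cBnat]
  | succ n ih => rw [cBnat, ih, Finset.prod_range_succ, mul_comm]

theorem cBnat_egf (k : ℕ) :
    PowerSeries.C (k.factorial : ℚ) *
        PowerSeries.mk (fun n => (cBnat n k : ℚ) / n.factorial)
      = PowerSeries.mk
          (fun n => ((∏ j ∈ Finset.range n, (2*j+1) : ℕ) : ℚ) / n.factorial) *
        (PowerSeries.mk (fun n => if n = 0 then 0 else (2:ℚ)^(n-1) / n))^k := by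
  induction k with
  | zero => simp [cBnat_zero_right]
  | succ k ih =>
    have hS := one_sub_two_X_mul_derivative_oddFactorial
    have hL := one_sub_two_X_mul_derivative_log
    have hA := one_sub_two_X_mul_derivative_cBnat_succ k
    have hL₀ : constantCoeff
        (PowerSeries.mk (fun n => if n = 0 then 0 else (2:ℚ)^(n-1) / n)) = 0 := by
      simp [← coeff_zero_eq_constantCoeff_apply]
    have hA₀ : constantCoeff
        (PowerSeries.mk (fun n => (cBnat n (k + 1) : ℚ) / n.factorial)) = 0 := by
      simp [← coeff_zero_eq_constantCoeff_apply, cBnat]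
    generalize PowerSeries.mk
      (fun n => ((∏ j ∈ Finset.range n, (2*j+1) : ℕ) : ℚ) / n.factorial) = S at *
    generalize PowerSeries.mk (fun n => if n = 0 then 0 else (2:ℚ)^(n-1) / n) = L at *
    generalize PowerSeries.mk (fun n => (cBnat n (k + 1) : ℚ) / n.factorial) = A at *
    generalize PowerSeries.mk (fun n => (cBnat n k : ℚ) / n.factorial) = B at *
    refine eq_of_one_sub_two_X_mul_derivative (g := (k + 1) * (S * L ^ k)) ?_ ?_ ?_
    · rw [← ih, Nat.factorial_succ, Derivation.leibniz, derivative_C]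
      simp only [smul_eq_mul, Nat.cast_mul, map_mul, map_natCast]
      push_cast
      linear_combination ((k + 1 : ℚ⟦X⟧) * (k.factorial : ℚ⟦X⟧)) * hA
    · rw [Derivation.leibniz, Derivation.leibniz_pow]
      simp only [smul_eq_mul, nsmul_eq_mul, Nat.add_sub_cancel]
      push_cast
      linear_combination L ^ (k + 1) * hS + (k + 1) * S * L ^ k * hL
    · simp [hA₀, hL₀]
end
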